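/- If a compact metric space (X,d) satisfies condition (⋆), then X is homeomorphic to a subset of the real line; that is, there exists a topological embedding of X into ℝ. -/

import Mathlib

/-- Condition (⋆). -/
def SatisfiesStar (X : Type*) [TopologicalSpace X] : Prop :=
  ∀ x : X, (connectedComponent x).Nontrivial →
    ∃ h : ↥(Set.Icc (0:ℝ) 1) ≃ₜ ↥(connectedComponent x),
      IsOpen (connectedComponent x \
        {((h ⟨0, by norm_num⟩ : ↥(connectedComponent x)) : X),
         ((h ⟨1, by norm_num⟩ : ↥(connectedComponent x)) : X)})

/-- `c` assigns to each point its cell in a finite or infinite row of cells; a fibre of `p` lies in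
one cell or in two consecutive ones, and at most one fibre crosses between two given cells. -/
structure IsFibreRow {Y Z : Type*} [TopologicalSpace Y] (p : Y → Z) (c : Y → ℕ) : Prop where
  continuous : Continuous c
  le_add_one : ∀ x y, p x = p y → c x ≤ c y + 1
  crossing_unique : ∀ x x' y y', p x = p x' → p y = p y' → c x = c y → c x' = c x + 1 →
    c y' = c y + 1 → p x = p y

namespace IsFibreRow

variable {Y Z : Type*} [TopologicalSpace Y] {p : Y → Z} {c : Y → ℕ}

theorem const : IsFibreRow p (fun _ => 0) where
  continuous := continuous_const
  le_add_one := by simp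
  crossing_unique := by simp

/-- Splitting every cell in two along `w`. -/
theorem split (hc : IsFibreRow p c) {w : Y → ℕ} (hw : Continuous w) (hw1 : ∀ x, w x ≤ 1)
    (hcross : ∀ x x', p x = p x' → c x' = c x + 1 → w x = 1 ∧ w x' = 0)
    (hcut : ∀ x x' y y', p x = p x' → p y = p y' → c x = c y → c x' = c x → c y' = c y →
      w x ≠ w x' → w y ≠ w y' → p x = p y) :
    IsFibreRow p (fun y => 2 * c y + w y) where
  continuous := (continuous_const.mul hc.continuous).add hw
  le_add_one x y h := by
    have h1 := hc.le_add_one x y h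
    have h2 := hcross y x h.symm
    have := hw1 x
    by_cases h3 : c x = c y + 1
    · have := h2 h3
      omega
    · omega
  crossing_unique x x' y y' hx hy hxy hx' hy' := by
    have a1 := hw1 x
    have a2 := hw1 x'
    have a3 := hw1 y
    have a4 := hw1 y'
    by_cases h : c x' = c x
    · exact hcut x x' y y' hx hy (by omega) h (by omega) (by omega) (by omega)
    · exact hc.crossing_unique x x' y y' hx hy (by omega) (by omega) (by omega)

/-- If no cell contains endpoints of crossing fibres on both sides, it can be split along a clopen
set `T` which cuts at most one fibre. -/
theorem split_of_one_sided (hc : IsFibreRow p c)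
    (hp2 : ∀ x y z, p x = p y → p y = p z → x = y ∨ y = z ∨ x = z)
    (hone : ∀ x x' y y', p x = p x' → p y = p y' → c x' = c x + 1 → c y = c y' + 1 → c x ≠ c y)
    {T : Set Y} (hT : IsClopen T)
    (hcut : ∀ x x' y y', p x = p x' → p y = p y' → x ∈ T → x' ∉ T → y ∈ T → y' ∉ T → p x = p y) :
    ∃ c', IsFibreRow p c' ∧ (∀ x y, c x < c y → c' x < c' y) ∧
      ∀ x y, c' x = c' y → (x ∈ T ↔ y ∈ T) := by
  classical
  let flip : Set ℕ := {k | (∃ x x', p x = p x' ∧ c x = k ∧ c x = c x' + 1 ∧ x ∈ T) ∨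
    ∃ x x', p x = p x' ∧ c x = k ∧ c x' = c x + 1 ∧ x ∉ T}
  have hflip_lower : ∀ x x', p x = p x' → c x = c x' + 1 → (x ∈ T ↔ c x ∈ flip) := by
    intro x x' hx hxx
    refine ⟨fun h => Or.inl ⟨x, x', hx, rfl, hxx, h⟩, ?_⟩
    rintro (⟨y, y', hy, hyx, hyy, h⟩ | ⟨y, y', hy, hyx, hyy, -⟩)
    · have := hc.crossing_unique x' x y' y hx.symm hy.symm (by omega) hxx hyy
      rcases hp2 x x' y hx (this.trans hy.symm) with e | e | e
      · subst e; omega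
      · subst e; omega
      · rwa [e]
    · exact (hone y y' x x' hy hx hyy hxx hyx).elim
  have hflip_upper : ∀ x x', p x = p x' → c x' = c x + 1 → (x ∉ T ↔ c x ∈ flip) := by
    intro x x' hx hxx
    refine ⟨fun h => Or.inr ⟨x, x', hx, rfl, hxx, h⟩, ?_⟩
    rintro (⟨y, y', hy, hyx, hyy, h⟩ | ⟨y, y', hy, hyx, hyy, h⟩)
    · exact (hone x x' y y' hx hy hxx hyy hyx.symm).elim
    · have := hc.crossing_unique x x' y y' hx hy hyx.symm hxx hyy
      rcases hp2 x' x y hx.symm this with e | e | e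
      · subst e; omega
      · rwa [e]
      · subst e; omega
  have hF : IsClopen (c ⁻¹' flip) := (isClopen_discrete flip).preimage hc.continuous
  let S : Set Y := (T ∩ (c ⁻¹' flip)ᶜ) ∪ (Tᶜ ∩ c ⁻¹' flip)
  have hS : IsClopen S := (hT.inter hF.compl).union (hT.compl.inter hF)
  have hmem : ∀ y, y ∈ S ↔ ¬ (y ∈ T ↔ c y ∈ flip) := by
    intro y
    simp only [S, Set.mem_union, Set.mem_inter_iff, Set.mem_compl_iff, Set.mem_preimage]
    tauto
  have hw01 : ∀ y, LocallyConstant.charFn ℕ hS y = if y ∈ S then 1 else 0 := fun y => by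
    simp [LocallyConstant.coe_charFn, Set.indicator]
  have hle : ∀ y, LocallyConstant.charFn ℕ hS y ≤ 1 := fun y => by
    rw [hw01]; split_ifs <;> simp
  refine ⟨_, hc.split (w := LocallyConstant.charFn ℕ hS) (LocallyConstant.continuous _) hle
    ?_ ?_, ?_, ?_⟩
  · intro x x' hx hxx
    have h1 := hflip_upper x x' hx hxx
    have h2 := hflip_lower x' x hx.symm hxx
    rw [hw01, hw01, if_pos ((hmem x).2 (by tauto)), if_neg (by rw [hmem]; tauto)]
    simp
  · have key : ∀ x x', c x' = c x → LocallyConstant.charFn ℕ hS x ≠ LocallyConstant.charFn ℕ hS x' →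
        (x ∈ T ∧ x' ∉ T) ∨ (x' ∈ T ∧ x ∉ T) := by
      intro x x' hx h
      by_contra hcon
      refine h ?_
      have : x ∈ S ↔ x' ∈ S := by
        rw [hmem, hmem, hx]; tauto
      simp only [hw01, this]
    intro x x' y y' hx hy _ hxx hyy hwx hwy
    rcases key x x' hxx hwx with ⟨h1, h2⟩ | ⟨h1, h2⟩ <;>
    rcases key y y' hyy hwy with ⟨h3, h4⟩ | ⟨h3, h4⟩
    · exact hcut x x' y y' hx hy h1 h2 h3 h4
    · exact (hcut x x' y' y hx hy.symm h1 h2 h3 h4).trans hy.symm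
    · exact hx.trans (hcut x' x y y' hx.symm hy h1 h2 h3 h4)
    · exact hx.trans ((hcut x' x y' y hx.symm hy.symm h1 h2 h3 h4).trans hy.symm)
  · intro x y hxy
    have := hle x
    omega
  · intro x y hxy
    have h1 := hle x
    have h2 := hle y
    have h3 : c x = c y := by omega
    have h4 : LocallyConstant.charFn ℕ hS x = LocallyConstant.charFn ℕ hS y := by omega
    have h5 : x ∈ S ↔ y ∈ S := by
      rw [hw01, hw01] at h4
      by_cases hx : x ∈ S <;> by_cases hy : y ∈ S <;> simp_all
    rw [hmem, hmem, h3] at h5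
    tauto

variable [TopologicalSpace Z] [TotallySeparatedSpace Z]

/-- In one cell, the endpoint of a crossing fibre on the upper side and the one on the lower side
are separated by a clopen set of the base. -/
theorem exists_isClopen_base (hc : IsFibreRow p c)
    (hp2 : ∀ x y z, p x = p y → p y = p z → x = y ∨ y = z ∨ x = z) (k : ℕ) :
    ∃ V : Set Z, IsClopen V ∧
      (∀ x x', p x = p x' → c x = k → c x' = k + 1 → p x ∈ V) ∧
      (∀ x x', p x = p x' → c x = k → c x = c x' + 1 → p x ∉ V) := by
  by_cases hu : ∃ x x', p x = p x' ∧ c x = k ∧ c x' = k + 1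
  · by_cases hl : ∃ x x', p x = p x' ∧ c x = k ∧ c x = c x' + 1
    · obtain ⟨u, u', hu, hu1, hu2⟩ := hu
      obtain ⟨l, l', hl, hl1, hl2⟩ := hl
      have hne : p u ≠ p l := by
        intro h
        rcases hp2 u u' l' hu (by rw [← hu, h, hl]) with e | e | e <;> subst e <;> omega
      obtain ⟨V, hV, h1, h2⟩ := exists_isClopen_of_totally_separated hne
      refine ⟨V, hV, fun x x' hx a b => ?_, fun x x' hx a b hm => h2 ?_⟩
      · rwa [hc.crossing_unique x x' u u' hx hu (by omega) (by omega) (by omega)]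
      · rwa [hl, ← hc.crossing_unique x' x l' l hx.symm hl.symm (by omega) (by omega) (by omega),
          ← hx]
    · exact ⟨Set.univ, isClopen_univ, fun _ _ _ _ _ => trivial,
        fun x x' hx a b => (hl ⟨x, x', hx, a, b⟩).elim⟩
  · exact ⟨∅, isClopen_empty, fun x x' hx a b => (hu ⟨x, x', hx, a, b⟩).elim,
      fun _ _ _ _ _ => id⟩

/-- A row of cells can be refined so that no cell contains endpoints of crossing fibres on both
sides. -/
theorem exists_one_sided_refinement (hc : IsFibreRow p c) (hp : Continuous p)
    (hp2 : ∀ x y z, p x = p y → p y = p z → x = y ∨ y = z ∨ x = z) :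
    ∃ c', IsFibreRow p c' ∧ (∀ x y, c x < c y → c' x < c' y) ∧
      ∀ x x' y y', p x = p x' → p y = p y' → c' x' = c' x + 1 → c' y = c' y' + 1 →
        c' x ≠ c' y := by
  classical
  choose V hV hVu hVl using hc.exists_isClopen_base hp2
  have hW : IsClopen {y | p y ∈ V (c y)} := by
    have key : ∀ S : ℕ → Set Z, (∀ k, IsOpen (S k)) → IsOpen {y | p y ∈ S (c y)} := by
      intro S hS
      have : {y | p y ∈ S (c y)} = ⋃ k, c ⁻¹' {k} ∩ p ⁻¹' S k := by
        ext; simp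
      rw [this]
      exact isOpen_iUnion fun k => ((isOpen_discrete _).preimage hc.continuous).inter
        ((hS k).preimage hp)
    exact ⟨⟨key (fun k => (V k)ᶜ) fun k => (hV k).1.isOpen_compl⟩, key V fun k => (hV k).2⟩
  have hw01 : ∀ y, LocallyConstant.charFn ℕ hW y = if p y ∈ V (c y) then 1 else 0 := fun y => by
    simp [LocallyConstant.coe_charFn, Set.indicator]
  have hle : ∀ y, LocallyConstant.charFn ℕ hW y ≤ 1 := fun y => by
    rw [hw01]; split_ifs <;> simp
  have hcross : ∀ x x', p x = p x' → c x' = c x + 1 →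
      LocallyConstant.charFn ℕ hW x = 1 ∧ LocallyConstant.charFn ℕ hW x' = 0 := by
    intro x x' hx hxx
    rw [hw01, hw01, if_pos (hVu _ x x' hx rfl hxx), if_neg (hVl _ x' x hx.symm rfl hxx)]
    simp
  have hsame : ∀ x x', p x = p x' → c x' = c x →
      LocallyConstant.charFn ℕ hW x = LocallyConstant.charFn ℕ hW x' := by
    intro x x' hx hxx
    rw [hw01, hw01, hx, hxx]
  refine ⟨_, hc.split (w := LocallyConstant.charFn ℕ hW) (LocallyConstant.continuous _) hle hcross
    fun x x' y y' hx _ _ hxx _ h => (h (hsame x x' hx hxx)).elim, ?_, ?_⟩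
  · intro x y hxy
    have := hle x
    omega
  · have hodd : ∀ x x', p x = p x' →
        2 * c x' + LocallyConstant.charFn ℕ hW x' = 2 * c x + LocallyConstant.charFn ℕ hW x + 1 →
        LocallyConstant.charFn ℕ hW x = 1 := by
      intro x x' hx h
      have h1 := hle x
      have h2 := hle x'
      by_cases hxx : c x' = c x
      · have := hsame x x' hx hxx
        omega
      · exact (hcross x x' hx (by omega)).1
    intro x x' y y' hx hy hxx hyy h
    have h1 := hodd x x' hx hxx
    have h2 := hodd y' y hy.symm hyy
    omega

/-- A row of cells can be refined so that no cell is cut by a given clopen set `T` which itself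
cuts at most one fibre. -/
theorem exists_refinement (hc : IsFibreRow p c) (hp : Continuous p)
    (hp2 : ∀ x y z, p x = p y → p y = p z → x = y ∨ y = z ∨ x = z)
    {T : Set Y} (hT : IsClopen T)
    (hcut : ∀ x x' y y', p x = p x' → p y = p y' → x ∈ T → x' ∉ T → y ∈ T → y' ∉ T → p x = p y) :
    ∃ c', IsFibreRow p c' ∧ (∀ x y, c x < c y → c' x < c' y) ∧
      ∀ x y, c' x = c' y → (x ∈ T ↔ y ∈ T) := by
  obtain ⟨c₁, h₁, hr₁, hone⟩ := hc.exists_one_sided_refinement hp hp2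
  obtain ⟨c₂, h₂, hr₂, hT₂⟩ := h₁.split_of_one_sided hp2 hone hT hcut
  exact ⟨c₂, h₂, fun x y h => hr₂ x y (hr₁ x y h), hT₂⟩

end IsFibreRow

/-- Let `c n` be integer-valued continuous functions, each refining the previous one and jointly
separating points. They define a continuous injective real function, ordered as they are. -/
theorem exists_continuous_injective_of_refining {Y : Type*} [TopologicalSpace Y] {c : ℕ → Y → ℕ}
    (hc : ∀ n, Continuous (c n)) (hr : ∀ n x y, c n x < c n y → c (n + 1) x < c (n + 1) y)
    (hsep : ∀ x y, x ≠ y → ∃ n, c n x ≠ c n y) :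
    ∃ g : Y → ℝ, Continuous g ∧ Function.Injective g ∧
      ∀ x y, g x < g y → ∃ n, ∀ m, n ≤ m → c m x < c m y := by
  have hmono : ∀ x y n m, n ≤ m → c n x < c n y → c m x < c m y := by
    intro x y n m hnm h
    induction m, hnm using Nat.le_induction with
    | base => exact h
    | succ k _ ih => exact hr k x y ih
  have hle : ∀ x y n, c n x < c n y → ∀ m, c m x ≤ c m y := by
    intro x y n h m
    by_contra! hcon
    have h1 := hmono x y n (max n m) (le_max_left _ _) h
    have h2 := hmono y x m (max n m) (le_max_right _ _) hcon
    omega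
  let F : ℕ → Y → ℝ := fun n y => (1 / 2) ^ n * (1 - (1 / 2) ^ c n y)
  have hpow : ∀ k : ℕ, 0 ≤ 1 - (1 / 2 : ℝ) ^ k ∧ 1 - (1 / 2 : ℝ) ^ k ≤ 1 := fun k =>
    ⟨sub_nonneg.2 (pow_le_one₀ (by norm_num) (by norm_num)), sub_le_self _ (by positivity)⟩
  have hF0 : ∀ n y, 0 ≤ F n y := fun n y => mul_nonneg (by positivity) (hpow _).1
  have hF1 : ∀ n y, F n y ≤ (1 / 2) ^ n := fun n y =>
    mul_le_of_le_one_right (by positivity) (hpow _).2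
  have hFs : ∀ y, Summable fun n => F n y := fun y =>
    Summable.of_nonneg_of_le (fun n => hF0 n y) (fun n => hF1 n y) summable_geometric_two
  have hlt : ∀ x y n, c n x < c n y → ∑' n, F n x < ∑' n, F n y := by
    intro x y n h
    refine Summable.tsum_lt_tsum (i := n) (fun m => ?_) ?_ (hFs x) (hFs y)
    · exact mul_le_mul_of_nonneg_left (sub_le_sub_left
        (pow_le_pow_of_le_one (by norm_num) (by norm_num) (hle x y n h m)) _) (by positivity)
    · exact mul_lt_mul_of_pos_left (sub_lt_sub_left
        (pow_lt_pow_right_of_lt_one₀ (by norm_num) (by norm_num) h) _) (by positivity)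
  refine ⟨fun y => ∑' n, F n y, ?_, ?_, ?_⟩
  · refine continuous_tsum (fun n => ?_) summable_geometric_two (fun n y => ?_)
    · exact continuous_const.mul (continuous_const.sub
        ((continuous_of_discreteTopology (f := fun k : ℕ => (1 / 2 : ℝ) ^ k)).comp (hc n)))
    · rw [Real.norm_of_nonneg (hF0 n y)]
      exact hF1 n y
  · intro x y hxy
    by_contra hne
    obtain ⟨n, hn⟩ := hsep x y hne
    rcases lt_or_gt_of_ne hn with h | h
    · exact (hlt x y n h).ne hxy
    · exact (hlt y x n h).ne' hxy
  · intro x y hxy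
    obtain ⟨n, hn⟩ := hsep x y (by rintro rfl; exact lt_irrefl _ hxy)
    rcases lt_or_gt_of_ne hn with h | h
    · exact ⟨n, fun m hm => hmono x y n m hm h⟩
    · exact ((hlt y x n h).not_gt hxy).elim

/-- If the fibres of `p` have at most two points and every two-point fibre is cut by a clopen set
that cuts no other fibre, then `Y` embeds into the line with the points of each fibre adjacent. -/
theorem exists_continuous_injective_fibres_adjacent {Y Z : Type*} [TopologicalSpace Y]
    [CompactSpace Y] [T2Space Y] [SecondCountableTopology Y] [TopologicalSpace Z]
    [TotallySeparatedSpace Z] {p : Y → Z} (hp : Continuous p)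
    (hp2 : ∀ x y z, p x = p y → p y = p z → x = y ∨ y = z ∨ x = z)
    (hK : ∀ a b, a ≠ b → p a = p b → ∃ K : Set Y, IsClopen K ∧ a ∈ K ∧ b ∉ K ∧
      ∀ x y, p x = p y → p x ≠ p a → x ∈ K → y ∈ K) :
    ∃ g : Y → ℝ, Continuous g ∧ Function.Injective g ∧
      ∀ a b y, p a = p b → g y ∉ Set.Ioo (g a) (g b) := by
  let CutsOne : Set Y → Prop := fun T => ∀ x x' y y', p x = p x' → p y = p y' →
    x ∈ T → x' ∉ T → y ∈ T → y' ∉ T → p x = p y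
  have hsep : ∀ a b : Y, a ≠ b → ∃ K : Set Y, IsClopen K ∧ CutsOne K ∧ a ∈ K ∧ b ∉ K := by
    intro a b hab
    by_cases h : p a = p b
    · obtain ⟨K, hKc, ha, hb, hK⟩ := hK a b hab h
      have key : ∀ x x', p x = p x' → x ∈ K → x' ∉ K → p x = p a := fun x x' hx h1 h2 =>
        by_contra fun hne => h2 (hK x x' hx hne h1)
      exact ⟨K, hKc, fun x x' y y' hx hy h1 h2 h3 h4 =>
        (key x x' hx h1 h2).trans (key y y' hy h3 h4).symm, ha, hb⟩
    · obtain ⟨V, hV, ha, hb⟩ := exists_isClopen_of_totally_separated h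
      refine ⟨p ⁻¹' V, hV.preimage hp, fun x x' y y' hx _ h1 h2 _ _ => (h2 ?_).elim, ha, hb⟩
      rwa [Set.mem_preimage, ← hx]
  have : TotallySeparatedSpace Y := totallySeparatedSpace_iff_exists_isClopen.2 fun a b hab =>
    let ⟨K, hKc, _, ha, hb⟩ := hsep a b hab
    ⟨K, hKc, ha, hb⟩
  have : Countable (TopologicalSpace.Clopens Y) :=
    TopologicalSpace.Clopens.countable_iff_secondCountable.2 inferInstance
  obtain ⟨e, he⟩ := exists_surjective_nat (TopologicalSpace.Clopens Y)
  have step : ∀ (n : ℕ) (c : {c : Y → ℕ // IsFibreRow p c}), ∃ c' : {c : Y → ℕ // IsFibreRow p c},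
      (∀ x y, c.1 x < c.1 y → c'.1 x < c'.1 y) ∧
      (CutsOne (e n) → ∀ x y, c'.1 x = c'.1 y → (x ∈ e n ↔ y ∈ e n)) := by
    intro n c
    by_cases h : CutsOne (e n)
    · obtain ⟨c', h1, h2, h3⟩ := c.2.exists_refinement hp hp2 (e n).isClopen h
      exact ⟨⟨c', h1⟩, h2, fun _ => h3⟩
    · exact ⟨c, fun _ _ => id, fun h' => (h h').elim⟩
  choose next hnext_lt hnext_sep using step
  let c : ℕ → {c : Y → ℕ // IsFibreRow p c} := fun n =>
    Nat.rec ⟨_, IsFibreRow.const⟩ next n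
  obtain ⟨g, hgc, hgi, hg⟩ := exists_continuous_injective_of_refining (c := fun n => (c n).1)
    (fun n => (c n).2.continuous) (fun n => hnext_lt n (c n)) (by
      intro x y hxy
      obtain ⟨K, hKc, hK1, hx, hy⟩ := hsep x y hxy
      obtain ⟨n, hn⟩ := he ⟨K, hKc⟩
      refine ⟨n + 1, fun h => hy ?_⟩
      have := hnext_sep n (c n) (by rw [hn]; exact hK1) x y h
      rw [hn] at this
      exact this.1 hx)
  refine ⟨g, hgc, hgi, fun a b y hab hy => ?_⟩
  obtain ⟨n, hn⟩ := hg a y hy.1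
  obtain ⟨m, hm⟩ := hg y b hy.2
  have h1 := hn (max n m) (le_max_left _ _)
  have h2 := hm (max n m) (le_max_right _ _)
  have h3 := (c (max n m)).2.le_add_one b a hab.symm
  omega

/-- In a compact Hausdorff space, an open set containing a connected component contains a clopen
neighbourhood of it. -/
theorem exists_isClopen_of_connectedComponent_subset {X : Type*} [TopologicalSpace X]
    [CompactSpace X] [T2Space X] {x : X} {U : Set X} (hU : IsOpen U)
    (hxU : connectedComponent x ⊆ U) : ∃ K : Set X, IsClopen K ∧ x ∈ K ∧ K ⊆ U := by
  rw [connectedComponent_eq_iInter_isClopen] at hxU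
  have : Nonempty {s : Set X // IsClopen s ∧ x ∈ s} := ⟨⟨Set.univ, isClopen_univ, trivial⟩⟩
  obtain ⟨⟨K, hK, hxK⟩, hKU⟩ := exists_subset_nhds_of_compactSpace
    (V := fun s : {s : Set X // IsClopen s ∧ x ∈ s} => (s : Set X))
    (fun s t => ⟨⟨s ∩ t, s.2.1.inter t.2.1, s.2.2, t.2.2⟩, Set.inter_subset_left,
      Set.inter_subset_right⟩) (fun s => s.2.1.1) (fun y hy => hU.mem_nhds (hxU hy))
  exact ⟨K, hK, hxK, hKU⟩

/-- If a component of `X` becomes finite by removing an open part `D` of it, then its remaining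
points have small clopen neighbourhoods in `Dᶜ`, and these cut no other component. -/
theorem exists_isClopen_compl_of_finite_diff {X : Type*} [TopologicalSpace X] [CompactSpace X]
    [T2Space X] {x : X} {D U : Set X} (hD : IsOpen D) (hDC : D ⊆ connectedComponent x)
    (hfin : (connectedComponent x \ D).Finite) (hxD : x ∉ D) (hU : IsOpen U) (hxU : x ∈ U) :
    ∃ K V : Set X, IsClosed K ∧ IsOpen V ∧ K = V ∩ Dᶜ ∧ x ∈ K ∧ K ⊆ U ∧
      ∀ y y' : X, (y : ConnectedComponents X) = y' → (y : ConnectedComponents X) ≠ x →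
        y ∈ K → y' ∈ K := by
  have : CompactSpace ↥Dᶜ := isCompact_iff_compactSpace.1 hD.isClosed_compl.isCompact
  have hcomp : connectedComponent (⟨x, hxD⟩ : ↥Dᶜ) ⊆ Subtype.val ⁻¹' U := by
    have hpre : IsPreconnected (Subtype.val '' connectedComponent (⟨x, hxD⟩ : ↥Dᶜ)) :=
      isPreconnected_connectedComponent.image _ continuous_subtype_val.continuousOn
    have hmem : x ∈ Subtype.val '' connectedComponent (⟨x, hxD⟩ : ↥Dᶜ) :=
      ⟨_, mem_connectedComponent, rfl⟩
    have hsub : Subtype.val '' connectedComponent (⟨x, hxD⟩ : ↥Dᶜ) ⊆ connectedComponent x \ D := by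
      rintro y hy
      refine ⟨hpre.subset_connectedComponent hmem hy, ?_⟩
      obtain ⟨w, -, rfl⟩ := hy
      exact w.2
    have hss : (Subtype.val '' connectedComponent (⟨x, hxD⟩ : ↥Dᶜ)).Subsingleton :=
      Set.not_nontrivial_iff.1 fun h => hpre.infinite_of_nontrivial h (hfin.subset hsub)
    intro w hw
    have : (w : X) = x := hss ⟨w, hw, rfl⟩ hmem
    rwa [Set.mem_preimage, this]
  obtain ⟨K, hK, hxK, hKU⟩ := exists_isClopen_of_connectedComponent_subset
    (hU.preimage continuous_subtype_val) hcomp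
  obtain ⟨V, hV, hVK⟩ := isOpen_induced_iff.1 hK.2
  refine ⟨Subtype.val '' K, V, hD.isClosed_compl.isClosedMap_subtype_val _ hK.1, hV, ?_,
    ⟨_, hxK, rfl⟩, by rintro _ ⟨w, hw, rfl⟩; exact hKU hw, ?_⟩
  · rw [← hVK, Subtype.image_preimage_coe, Set.inter_comm]
  · rintro _ y' hyy hyx ⟨w, hw, rfl⟩
    have hsub : connectedComponent (w : X) ⊆ Dᶜ := by
      intro v hv hvD
      refine hyx ?_
      rw [← ConnectedComponents.coe_eq_coe'.2 hv, ConnectedComponents.coe_eq_coe'.2 (hDC hvD)]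
    have hpre : IsPreconnected (Subtype.val ⁻¹' connectedComponent (w : X) : Set ↥Dᶜ) := by
      refine Topology.IsInducing.subtypeVal.isPreconnected_image.1 ?_
      rw [Subtype.image_preimage_coe, Set.inter_eq_right.2 hsub]
      exact isPreconnected_connectedComponent
    have hy' : y' ∈ connectedComponent (w : X) := ConnectedComponents.coe_eq_coe'.1 hyy.symm
    exact ⟨⟨y', hsub hy'⟩, hpre.subset_isClopen hK ⟨w, mem_connectedComponent, hw⟩ hy', rfl⟩

/-- Condition (⋆) in terms of a uniform family of parametrisations of all components, the
one-point ones being parametrised by constant maps. -/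
theorem SatisfiesStar.exists_parametrisation {X : Type*} [TopologicalSpace X]
    (hstar : SatisfiesStar X) (z : ConnectedComponents X) :
    ∃ γ : C(unitInterval, X), (∀ x : X, x ∈ Set.range γ ↔ (x : ConnectedComponents X) = z) ∧
      (Function.Injective γ ∨ ∀ s t, γ s = γ t) ∧ IsOpen (Set.range γ \ {γ 0, γ 1}) := by
  obtain ⟨x, rfl⟩ := ConnectedComponents.surjective_coe z
  by_cases hx : (connectedComponent x).Nontrivial
  · obtain ⟨h, hopen⟩ := hstar x hx
    have hrange : Set.range (fun t : unitInterval => (h t : X)) = connectedComponent x := by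
      rw [← Function.comp_def, h.surjective.range_comp, Subtype.range_coe]
    refine ⟨⟨fun t => h t, continuous_subtype_val.comp h.continuous⟩, fun y => ?_,
      Or.inl (Subtype.val_injective.comp h.injective), ?_⟩
    · rw [ContinuousMap.coe_mk, hrange, ConnectedComponents.coe_eq_coe']
    · rw [ContinuousMap.coe_mk, hrange]
      exact hopen
  · rw [Set.not_nontrivial_iff] at hx
    refine ⟨ContinuousMap.const _ x, fun y => ?_, Or.inr fun _ _ => rfl, ?_⟩
    · rw [ConnectedComponents.coe_eq_coe']
      constructor
      · rintro ⟨_, rfl⟩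
        exact mem_connectedComponent
      · exact fun hy => ⟨0, hx mem_connectedComponent hy⟩
    · convert isOpen_empty
      ext y
      simp +contextual [eq_comm]

theorem notMem_uIcc_of_notMem_Ioo {α : Type*} [LinearOrder α] {a b c : α} (h₁ : c ∉ Set.Ioo a b)
    (h₂ : c ∉ Set.Ioo b a) (ha : c ≠ a) (hb : c ≠ b) : c ∉ Set.uIcc a b := by
  simp only [Set.mem_uIcc, Set.mem_Ioo] at *
  grind

theorem disjoint_uIcc {α : Type*} [LinearOrder α] {a b c d : α} (ha : a ∉ Set.uIcc c d)
    (hb : b ∉ Set.uIcc c d) (hc : c ∉ Set.uIcc a b) (hd : d ∉ Set.uIcc a b) :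
    Disjoint (Set.uIcc a b) (Set.uIcc c d) := by
  rw [Set.disjoint_left]
  intro x
  simp only [Set.mem_uIcc] at *
  grind

section Parametrised

variable {X : Type*} [TopologicalSpace X] {γ : ConnectedComponents X → C(unitInterval, X)}

/-- The endpoints of the parametrised components. -/
def componentEndpoints (γ : ConnectedComponents X → C(unitInterval, X)) : Set X :=
  {x | x = γ x 0 ∨ x = γ x 1}

theorem isClosed_componentEndpoints
    (hγ : ∀ z (x : X), x ∈ Set.range (γ z) ↔ (x : ConnectedComponents X) = z)
    (hopen : ∀ z, IsOpen (Set.range (γ z) \ {γ z 0, γ z 1})) :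
    IsClosed (componentEndpoints γ) := by
  rw [← isOpen_compl_iff]
  convert isOpen_iUnion hopen
  ext x
  simp only [componentEndpoints, Set.mem_compl_iff, Set.mem_ofPred_eq, Set.mem_iUnion,
    Set.mem_sdiff, hγ, Set.mem_insert_iff, Set.mem_singleton_iff, exists_eq_left']

theorem coe_param (hγ : ∀ z (x : X), x ∈ Set.range (γ z) ↔ (x : ConnectedComponents X) = z)
    (z : ConnectedComponents X) (t : unitInterval) : (γ z t : ConnectedComponents X) = z :=
  (hγ z _).1 ⟨t, rfl⟩

theorem param_zero_mem (hγ : ∀ z (x : X), x ∈ Set.range (γ z) ↔ (x : ConnectedComponents X) = z)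
    (z : ConnectedComponents X) : γ z 0 ∈ componentEndpoints γ :=
  Or.inl (by rw [coe_param hγ])

theorem param_one_mem (hγ : ∀ z (x : X), x ∈ Set.range (γ z) ↔ (x : ConnectedComponents X) = z)
    (z : ConnectedComponents X) : γ z 1 ∈ componentEndpoints γ :=
  Or.inr (by rw [coe_param hγ])

theorem exists_clopen_at_endpoint [CompactSpace X] [T2Space X]
    (hγ : ∀ z (x : X), x ∈ Set.range (γ z) ↔ (x : ConnectedComponents X) = z)
    (hopen : ∀ z, IsOpen (Set.range (γ z) \ {γ z 0, γ z 1})) {x : X}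
    (hx : x ∈ componentEndpoints γ) {U : Set X} (hU : IsOpen U) (hxU : x ∈ U) :
    ∃ K V : Set X, IsClosed K ∧ IsOpen V ∧
      K = V ∩ (Set.range (γ x) \ {γ x 0, γ x 1})ᶜ ∧ x ∈ K ∧ K ⊆ U ∧
      ∀ y y' : X, (y : ConnectedComponents X) = y' → (y : ConnectedComponents X) ≠ x →
        y ∈ K → y' ∈ K := by
  have hrange : Set.range (γ x) = connectedComponent x := by
    ext y
    rw [hγ, ConnectedComponents.coe_eq_coe']
  refine exists_isClopen_compl_of_finite_diff (hopen x) (hrange ▸ Set.sdiff_subset) ?_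
    (fun h => h.2 hx) hU hxU
  rw [← hrange, Set.sdiff_sdiff_right_self]
  exact (Set.toFinite {γ x 0, γ x 1}).subset Set.inter_subset_right

/-- The endpoints embed into the line so that the two ends of each component are adjacent. -/
theorem exists_embedding_componentEndpoints [CompactSpace X] [T2Space X]
    [SecondCountableTopology X]
    (hγ : ∀ z (x : X), x ∈ Set.range (γ z) ↔ (x : ConnectedComponents X) = z)
    (hopen : ∀ z, IsOpen (Set.range (γ z) \ {γ z 0, γ z 1})) :
    ∃ g : componentEndpoints γ → ℝ, Continuous g ∧ Function.Injective g ∧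
      ∀ a b y : componentEndpoints γ, ((a : X) : ConnectedComponents X) = (b : X) →
        g y ∉ Set.Ioo (g a) (g b) := by
  have : CompactSpace (componentEndpoints γ) :=
    isCompact_iff_compactSpace.1 (isClosed_componentEndpoints hγ hopen).isCompact
  refine exists_continuous_injective_fibres_adjacent
    (p := fun a : componentEndpoints γ => ((a : X) : ConnectedComponents X))
    (ConnectedComponents.continuous_coe.comp continuous_subtype_val) ?_ ?_
  · rintro ⟨x, hx⟩ ⟨y, hy⟩ ⟨z, hz⟩ hxy hyz
    have hx' : x = γ x 0 ∨ x = γ x 1 := hx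
    have hy' : y = γ y 0 ∨ y = γ y 1 := hy
    have hz' : z = γ z 0 ∨ z = γ z 1 := hz
    dsimp only at hxy hyz
    rw [hxy] at hx'
    rw [← hyz] at hz'
    rw [Subtype.mk.injEq, Subtype.mk.injEq, Subtype.mk.injEq]
    grind
  · rintro ⟨a, ha⟩ ⟨b, hb⟩ hab hp
    obtain ⟨K, V, hK, hV, hKV, haK, hKb, hsat⟩ := exists_clopen_at_endpoint hγ hopen ha
      (isOpen_compl_singleton (x := b)) (by simpa using hab)
    refine ⟨Subtype.val ⁻¹' K, ⟨hK.preimage continuous_subtype_val, ?_⟩, haK,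
      fun h => hKb h rfl, fun x y hxy hne hx => hsat x y hxy hne hx⟩
    convert hV.preimage continuous_subtype_val using 1
    ext y
    rw [Set.mem_preimage, hKV]
    refine ⟨fun h => h.1, fun h => ⟨h, fun h' => h'.2 ?_⟩⟩
    rw [← (hγ a y).1 h'.1]
    exact y.2

/-- A function that is affine in the parameter of each component and continuous on the endpoints
is continuous. -/
theorem continuous_of_affine_on_components [CompactSpace X] [T2Space X]
    (hγ : ∀ z (x : X), x ∈ Set.range (γ z) ↔ (x : ConnectedComponents X) = z)
    (hopen : ∀ z, IsOpen (Set.range (γ z) \ {γ z 0, γ z 1})) {f : X → ℝ}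
    (hend : ContinuousOn f (componentEndpoints γ))
    (haff : ∀ z t, f (γ z t) = AffineMap.lineMap (f (γ z 0)) (f (γ z 1)) (t : ℝ)) :
    Continuous f := by
  rw [continuous_iff_continuousAt]
  intro x
  have hxr : x ∈ Set.range (γ x) := (hγ _ _).2 rfl
  have hcomp : ContinuousOn f (Set.range (γ x)) := by
    have hq : Topology.IsQuotientMap (Set.rangeFactorization (γ x)) :=
      Topology.IsQuotientMap.of_surjective_continuous Set.rangeFactorization_surjective
        (γ x).continuous.rangeFactorization
    rw [continuousOn_iff_continuous_domRestrict, hq.continuous_iff]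
    have : Set.domRestrict (Set.range (γ x)) f ∘ Set.rangeFactorization (γ x) =
        fun t : unitInterval => AffineMap.lineMap (f (γ x 0)) (f (γ x 1)) (t : ℝ) :=
      funext fun t => haff x t
    rw [this]
    exact AffineMap.lineMap_continuous.comp continuous_subtype_val
  by_cases hx : x ∈ componentEndpoints γ
  · rw [← continuousWithinAt_univ,
      ← Set.union_compl_self (Set.range (γ x) \ {γ x 0, γ x 1}), continuousWithinAt_union]
    refine ⟨(hcomp x hxr).mono Set.sdiff_subset, ?_⟩
    rw [Metric.continuousWithinAt_iff']
    intro ε hε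
    obtain ⟨O, hO, hxO, hOε⟩ := mem_nhdsWithin.1
      ((hend x hx).preimage_mem_nhdsWithin (Metric.ball_mem_nhds (f x) hε))
    obtain ⟨K, V, -, hV, hKV, hxK, hKO, hsat⟩ := exists_clopen_at_endpoint hγ hopen hx hO hxO
    have hxV : x ∈ V := by
      rw [hKV] at hxK
      exact hxK.1
    filter_upwards [inter_mem_nhdsWithin _ (hV.mem_nhds hxV)] with y hy
    have hyK : y ∈ K := hKV ▸ ⟨hy.2, hy.1⟩
    by_cases hyx : (y : ConnectedComponents X) = x
    · refine hOε ⟨hKO hyK, ?_⟩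
      by_contra hcon
      refine hy.1 ⟨(hγ _ _).2 hyx, ?_⟩
      rw [← hyx]
      exact hcon
    · have hend_mem : ∀ t, γ y t ∈ componentEndpoints γ → f (γ y t) ∈ Metric.ball (f x) ε :=
        fun t ht => hOε ⟨hKO (hsat y _ (coe_param hγ _ _).symm hyx hyK), ht⟩
      obtain ⟨t, ht⟩ := (hγ _ _).2 (rfl : (y : ConnectedComponents X) = y)
      rw [← Metric.mem_ball, ← ht, haff]
      exact (convex_ball (f x) ε).lineMap_mem (hend_mem 0 (param_zero_mem hγ _))
        (hend_mem 1 (param_one_mem hγ _)) t.2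
  · refine hcomp.continuousAt (Filter.mem_of_superset ((hopen x).mem_nhds ⟨hxr, hx⟩)
      Set.sdiff_subset)

/-- Extending an embedding of the endpoints affinely over the components. -/
theorem exists_continuous_injective_of_parametrisation [CompactSpace X] [T2Space X]
    [SecondCountableTopology X]
    (hγ : ∀ z (x : X), x ∈ Set.range (γ z) ↔ (x : ConnectedComponents X) = z)
    (hinj : ∀ z, Function.Injective (γ z) ∨ ∀ s t, γ z s = γ z t)
    (hopen : ∀ z, IsOpen (Set.range (γ z) \ {γ z 0, γ z 1})) :
    ∃ f : X → ℝ, Continuous f ∧ Function.Injective f := by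
  obtain ⟨g, hgc, hgi, hg⟩ := exists_embedding_componentEndpoints hγ hopen
  have hparam : ∀ x : X, ∃ t, γ x t = x := fun x => (hγ _ _).2 rfl
  choose τ hτ using hparam
  let left : ConnectedComponents X → componentEndpoints γ := fun z => ⟨γ z 0, param_zero_mem hγ z⟩
  let right : ConnectedComponents X → componentEndpoints γ := fun z => ⟨γ z 1, param_one_mem hγ z⟩
  let f : X → ℝ := fun x => AffineMap.lineMap (g (left x)) (g (right x)) (τ x : ℝ)
  have hfγ : ∀ z t, f (γ z t) = AffineMap.lineMap (g (left z)) (g (right z)) (t : ℝ) := by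
    intro z t
    have h := hτ (γ z t)
    simp only [f]
    rw [coe_param hγ] at h ⊢
    rcases hinj z with hz | hz
    · rw [hz h]
    · have : left z = right z := Subtype.ext (hz 0 1)
      rw [this, AffineMap.lineMap_same_apply, AffineMap.lineMap_same_apply]
  have hf0 : ∀ z, f (γ z 0) = g (left z) := fun z => by simp [hfγ]
  have hf1 : ∀ z, f (γ z 1) = g (right z) := fun z => by simp [hfγ]
  have hfg : ∀ y : componentEndpoints γ, f y = g y := by
    rintro ⟨y, hy | hy⟩
    · have : left y = ⟨y, Or.inl hy⟩ := Subtype.ext hy.symm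
      rw [← this]
      exact hf0 y
    · have : right y = ⟨y, Or.inr hy⟩ := Subtype.ext hy.symm
      rw [← this]
      exact hf1 y
  refine ⟨f, continuous_of_affine_on_components hγ hopen ?_ fun z t => by
    rw [hfγ, hf0, hf1], ?_⟩
  · rw [continuousOn_iff_continuous_domRestrict]
    exact hgc.congr fun y => (hfg y).symm
  · intro x y hxy
    by_cases hz : (x : ConnectedComponents X) = y
    · rw [← hτ x, ← hτ y, hz] at hxy ⊢
      rw [hfγ, hfγ] at hxy
      rcases hinj y with h | h
      · have hne : g (left y) ≠ g (right y) := fun e =>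
          zero_ne_one (h (Subtype.ext_iff.1 (hgi e)))
        rw [Subtype.ext (AffineMap.lineMap_injective ℝ hne hxy)]
      · exact h _ _
    · exfalso
      have hmem : ∀ x : X, f x ∈ Set.uIcc (g (left x)) (g (right x)) := by
        intro x
        rw [← segment_eq_uIcc, segment_eq_image_lineMap]
        exact ⟨τ x, (τ x).2, rfl⟩
      have hlr : ∀ z, ((left z : X) : ConnectedComponents X) = (right z : X) := fun z => by
        rw [coe_param hγ, coe_param hγ]
      have hout : ∀ (z : ConnectedComponents X) (w : componentEndpoints γ),
          ((w : X) : ConnectedComponents X) ≠ z → g w ∉ Set.uIcc (g (left z)) (g (right z)) := by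
        intro z w hw hwm
        have h1 := hg (left z) (right z) w (hlr z)
        have h2 := hg (right z) (left z) w (hlr z).symm
        have h3 : g w ≠ g (left z) := fun e => hw (by rw [hgi e, coe_param hγ])
        have h4 : g w ≠ g (right z) := fun e => hw (by rw [hgi e, coe_param hγ])
        exact notMem_uIcc_of_notMem_Ioo h1 h2 h3 h4 hwm
      have hx := hmem x
      have hy := hmem y
      rw [← hxy] at hy
      have h1 := hout y (left x) (by rwa [coe_param hγ])
      have h2 := hout y (right x) (by rwa [coe_param hγ])
      have h3 := hout x (left y) (by rw [coe_param hγ]; exact Ne.symm hz)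
      have h4 := hout x (right y) (by rw [coe_param hγ]; exact Ne.symm hz)
      exact Set.disjoint_left.1 (disjoint_uIcc h1 h2 h3 h4) hx hy

end Parametrised

/-- A compact metric space satisfying condition (⋆) embeds topologically
into the real line. -/
theorem embeds_in_real_of_star {X : Type*} [MetricSpace X] [CompactSpace X]
    (hstar : SatisfiesStar X) :
    ∃ f : X → ℝ, Topology.IsEmbedding f := by
  choose γ hγ hinj hopen using hstar.exists_parametrisation
  obtain ⟨f, hf, hfi⟩ := exists_continuous_injective_of_parametrisation hγ hinj hopen
  exact ⟨f, (hf.isClosedEmbedding hfi).isEmbedding⟩
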